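/- The Turán number ex₃(8;𝒫₄) equals 22, and the 𝒫₄-free 3-graphs on 8 vertices with 22 edges are, up to isomorphism, exactly the three 3-graphs S₈^{+1}, SP₈ and SK₈. -/

import Mathlib

open Finset

/-- `H` is a 3-graph on the vertex set `V`: every edge is a 3-element subset of `V`. -/
def ThreeGraphOn (V : Finset ℕ) (H : Finset (Finset ℕ)) : Prop :=
  ∀ e ∈ H, e ⊆ V ∧ e.card = 3

/-- Four edges form a 3-uniform minimal 4-path: `aᵢ ∩ aⱼ ≠ ∅ ↔ |i - j| ≤ 1`. -/
def IsMinPath4 (a₀ a₁ a₂ a₃ : Finset ℕ) : Prop :=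
  (a₀ ∩ a₁).Nonempty ∧ (a₁ ∩ a₂).Nonempty ∧ (a₂ ∩ a₃).Nonempty ∧
    a₀ ∩ a₂ = ∅ ∧ a₀ ∩ a₃ = ∅ ∧ a₁ ∩ a₃ = ∅

/-- `H` contains no minimal 4-path. -/
def P4Free (H : Finset (Finset ℕ)) : Prop :=
  ¬∃ a₀ ∈ H, ∃ a₁ ∈ H, ∃ a₂ ∈ H, ∃ a₃ ∈ H, IsMinPath4 a₀ a₁ a₂ a₃

/-- `H` is a starplus on `V`: a full star with center `v` together with one
extra 3-edge not containing `v`. -/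
def IsStarPlusOn (V : Finset ℕ) (H : Finset (Finset ℕ)) : Prop :=
  ∃ v ∈ V, ∃ e : Finset ℕ, e ⊆ V ∧ e.card = 3 ∧ v ∉ e ∧
    H = (V.powersetCard 3).filter (fun t => v ∈ t) ∪ {e}

/-- `H` is the `P`-star `SPₙ` on `V`: a minimal 2-path `f₁, f₂` (two 3-edges
sharing exactly one vertex) together with all triples of `V` containing a
vertex `v` outside the path and at least one vertex of the path. -/
def IsSPOn (V : Finset ℕ) (H : Finset (Finset ℕ)) : Prop :=
  ∃ v ∈ V, ∃ f₁ f₂ : Finset ℕ, f₁ ⊆ V ∧ f₂ ⊆ V ∧ f₁.card = 3 ∧ f₂.card = 3 ∧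
    (f₁ ∩ f₂).card = 1 ∧ v ∉ f₁ ∪ f₂ ∧
    H = {f₁, f₂} ∪
      (V.powersetCard 3).filter (fun t => v ∈ t ∧ (t ∩ (f₁ ∪ f₂)).Nonempty)

/-- `H` is the `K`-star `SKₙ` on `V`: a complete 3-graph on a 4-set `A`
together with all triples of `V` containing a vertex `v ∉ A` and at least one
vertex of `A`. -/
def IsSKOn (V : Finset ℕ) (H : Finset (Finset ℕ)) : Prop :=
  ∃ v ∈ V, ∃ A : Finset ℕ, A ⊆ V ∧ A.card = 4 ∧ v ∉ A ∧
    H = A.powersetCard 3 ∪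
      (V.powersetCard 3).filter (fun t => v ∈ t ∧ (t ∩ A).Nonempty)

namespace TP4

def tT : List ℕ := [7, 11, 13, 14, 19, 21, 22, 25, 26, 28, 35, 37, 38, 41, 42, 44, 49, 50, 52, 56,
  67, 69, 70, 73, 74, 76, 81, 82, 84, 88, 97, 98, 100, 104, 112, 131, 133, 134, 137, 138, 140,
  145, 146, 148, 152, 161, 162, 164, 168, 176, 193, 194, 196, 200, 208, 224]

def tab : ℕ :=
  1521466094915448908994827188423496878167348447881332247576323612863741744266804203610565530512285603529196101672196843594719729654761303611948019714075833051427727764304231843149292141204109807354494191059791477540537960075833993869105297115716981003086958229247771151079107753715891207796237351840942447357024948306664994304974000722533106251839218658621658413029873786944551542612252814121839459007683879332480436927693318381060372273011405274505356349080167403049322206570582504205364255885448144206511958032259006434531067914339293898999422075652948259876586106414599660923111668035053596279576605084025508550511363273255895133774280121336479641806992310547493986769257450398250552896818424408452668271257170278550318178212761700980389143949056313769965584243902259292743903186028190507976017874098588535480219136778315290761151727949909818682364847311084479247391638116784533558496631623490382189562900276906529371723538104320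

def ord1 : List ℕ := [10, 37, 45, 11, 49, 53, 50, 55, 46, 20, 52, 47, 34, 51, 33, 21, 22, 35, 54,
  48, 36, 30, 32, 39, 42, 31, 41, 38, 40, 27, 43, 24, 13, 16, 18, 12, 14, 26, 15, 25, 6, 23, 28,
  4, 9, 5, 7, 17, 1, 8, 44, 3, 2]

def ord2 : List ℕ := [50, 10, 12, 5, 4, 16, 54, 22, 18, 11, 55, 29, 52, 34, 51, 48, 36, 6, 17, 37,
  49, 30, 21, 43, 32, 41, 20, 31, 42, 45, 28, 27, 1, 47, 3, 35, 2, 46, 26, 9, 38, 24, 15, 25, 23,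
  44, 33, 40, 7, 8, 14, 39, 13]

def ord3 : List ℕ := [48, 22, 50, 30, 33, 37, 49, 35, 38, 43, 53, 27, 26, 20, 54, 34, 52, 28, 29,
  47, 31, 21, 39, 23, 40, 46, 32, 42, 51, 25, 24, 45, 41, 1, 9, 44, 4, 15, 10, 55, 7, 36, 6, 8,
  18, 3, 12, 11, 16, 13, 5, 17, 2, 14]

noncomputable section Search

/-- Evaluate a number before it is passed on. -/
def force (n : ℕ) (k : ℕ → Bool) : Bool :=
  Nat.rec (motive := fun _ => Bool) (k Nat.zero) (fun m _ => k (Nat.succ m)) n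

def nb (f J : ℕ) : ℕ := Nat.land (Nat.shiftRight tab (Nat.mul 56 f)) J

def okA (J NI f : ℕ) : Bool :=
  force (nb f J) fun nf =>
    Nat.rec (motive := fun _ => Bool) true
      (fun m _ =>
        Nat.rec (motive := fun _ => Bool) true
          (fun p _ => Nat.beq (nb (Nat.log2 (Nat.succ p)) J) nf)
          (nb (Nat.log2 (Nat.succ m)) J))
      (Nat.land nf NI)

def okB (J _NI f : ℕ) : Bool :=
  Nat.rec (motive := fun _ => Bool) true
    (fun m _ =>
      cond (Nat.beq (Nat.shiftLeft 1 (Nat.log2 (Nat.succ m))) (Nat.succ m))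
        (Nat.beq (nb (Nat.log2 (Nat.succ m)) J) 0) false)
    (nb f J)

def filt (ok : ℕ → Bool) (U : List ℕ) : ℕ → (List ℕ → ℕ → Bool) → Bool :=
  List.rec (motive := fun _ => ℕ → (List ℕ → ℕ → Bool) → Bool)
    (fun s k => k [] s)
    (fun f _ ih s k =>
      cond (ok f) (ih s (fun U' s' => k (f :: U') s'))
        (Nat.rec (motive := fun _ => Bool) true (fun s' _ => ih s' k) s))
    U

def go (ok : ℕ → ℕ → ℕ → Bool) (leaf : ℕ → Bool) (n : ℕ) :
    List ℕ → ℕ → ℕ → ℕ → Bool :=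
  Nat.rec (motive := fun _ => List ℕ → ℕ → ℕ → ℕ → Bool)
    (fun _ _ _ _ => false)
    (fun _ ih U J NI s =>
      List.rec (motive := fun _ => Bool) (leaf J)
        (fun f U _ =>
          cond
            (force (Nat.lor J (Nat.shiftLeft 1 f)) fun J' =>
              force (Nat.rec (motive := fun _ => ℕ) NI
                  (fun m _ => Nat.lor (Nat.lor NI (Nat.succ m)) (Nat.shiftLeft 1 f))
                  (nb f J)) fun NI' =>
                filt (ok J' NI') U s (fun U' s' => ih U' J' NI' s'))
            (Nat.rec (motive := fun _ => Bool) true (fun s' _ => ih U J NI s') s)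
            false)
        U)
    n

def start (ok : ℕ → ℕ → ℕ → Bool) (leaf : ℕ → Bool) (J : ℕ) (U : List ℕ) (s : ℕ) : Bool :=
  filt (ok J J) U s (fun U' s' => go ok leaf 57 U' J J s')

end Search

def tt (i : ℕ) : Finset (Fin 8) := Finset.univ.filter fun a => (tT.getD i 0).testBit a

def nsm : List ℕ := [70893931626156872, 69730303575173796, 67403150555571602, 62749394288974961,
  53447242038705167, 34938048197166079, 1125865548152831, 34359738367]

def fl : List (Fin 8) := [0, 1, 2, 3, 4, 5, 6, 7]

def StP (c : Fin 8) (f i : ℕ) : Prop := i = f ∨ c ∈ tt i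

def SPP (c : Fin 8) (f g i : ℕ) : Prop :=
  (i = f ∨ i = g) ∨ (c ∈ tt i ∧ (tt i ∩ (tt f ∪ tt g)).Nonempty)

def SKP (c : Fin 8) (A : Finset (Fin 8)) (i : ℕ) : Prop :=
  tt i ⊆ A ∨ (c ∈ tt i ∧ (tt i ∩ A).Nonempty)

instance (c f i) : Decidable (StP c f i) := by unfold StP; infer_instance
instance (c f g i) : Decidable (SPP c f g i) := by unfold SPP; infer_instance
instance (c A i) : Decidable (SKP c A i) := by unfold SKP; infer_instance

def StL (m : ℕ) (c : Fin 8) (f : ℕ) : Prop :=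
  f < 56 ∧ c ∉ tt f ∧ ∀ i < 56, m.testBit i = true ↔ StP c f i

def SPL (m : ℕ) (c : Fin 8) (f g : ℕ) : Prop :=
  f < 56 ∧ g < 56 ∧ c ∉ tt f ∪ tt g ∧ (tt f ∩ tt g).card = 1 ∧
    ∀ i < 56, m.testBit i = true ↔ SPP c f g i

def SKL (m : ℕ) (c : Fin 8) (A : Finset (Fin 8)) : Prop :=
  A.card = 4 ∧ c ∉ A ∧ ∀ i < 56, m.testBit i = true ↔ SKP c A i

instance (m c f) : Decidable (StL m c f) := by unfold StL; infer_instance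
instance (m c f g) : Decidable (SPL m c f g) := by unfold SPL; infer_instance
instance (m c A) : Decidable (SKL m c A) := by unfold SKL; infer_instance

def drp (r : ℕ) : ℕ := r ^^^ (1 <<< Nat.log2 r)

def leafAt (m : ℕ) (c : Fin 8) (r : ℕ) : Bool :=
  if drp r = 0 then decide (StL m c (Nat.log2 r))
  else if drp (drp r) = 0 then decide (SPL m c (Nat.log2 r) (Nat.log2 (drp r)))
  else if drp (drp (drp (drp r))) = 0 then
    decide (SKL m c (tt (Nat.log2 r) ∪ tt (Nat.log2 (drp r))))
  else false

def leaf (m : ℕ) : Bool := fl.any fun c => leafAt m c (m &&& nsm.getD c 0)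

theorem run3 : start okB leaf 524289 ord3 34 = true := by decide +kernel
theorem run2 : start okA leaf 9007199255265281 ord2 34 = true := by decide +kernel
theorem run1 : start okA leaf 537395201 ord1 34 = true := by decide +kernel

theorem tab_spec : ∀ i < 56, ∀ j < 56,
    tab.testBit (56 * i + j) = decide (tt i ∩ tt j = ∅) := by decide +kernel
theorem tt_card : ∀ i < 56, (tt i).card = 3 := by decide +kernel
theorem tt_inj : ∀ i < 56, ∀ j < 56, tt i = tt j → i = j := by decide +kernel
theorem tt_surj3 : ∀ a b c : Fin 8, a ≠ b → a ≠ c → b ≠ c → ∃ i, i < 56 ∧ tt i = {a, b, c} := by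
  decide +kernel
theorem force_eq (n : ℕ) (k : ℕ → Bool) : force n k = k n := by
  cases n <;> rfl

theorem nb_bit (f J j : ℕ) :
    (nb f J).testBit j = (tab.testBit (56 * f + j) && J.testBit j) := by
  change ((tab >>> (56 * f)) &&& J).testBit j = _
  rw [Nat.testBit_and, Nat.testBit_shiftRight]

def adj (i j : ℕ) : Prop := tab.testBit (56 * i + j) = true

theorem adj_iff {i j : ℕ} (hi : i < 56) (hj : j < 56) : adj i j ↔ tt i ∩ tt j = ∅ := by
  unfold adj
  rw [tab_spec i hi j hj]
  simp

theorem adj_symm {i j : ℕ} (hi : i < 56) (hj : j < 56) (h : adj i j) : adj j i := by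
  rw [adj_iff hi hj] at h
  rw [adj_iff hj hi, Finset.inter_comm]; exact h

theorem adj_tri {i j k : ℕ} (hi : i < 56) (hj : j < 56) (hk : k < 56)
    (h1 : adj i j) (h2 : adj j k) (h3 : adj i k) : False := by
  rw [adj_iff hi hj] at h1
  rw [adj_iff hj hk] at h2
  rw [adj_iff hi hk] at h3
  have e1 : (tt i ∪ tt j).card = 6 := by
    rw [Finset.card_union_of_disjoint (Finset.disjoint_iff_inter_eq_empty.2 h1),
      tt_card i hi, tt_card j hj]
  have e2 : (tt i ∪ tt j ∪ tt k).card = 9 := by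
    rw [Finset.card_union_of_disjoint, e1, tt_card k hk]
    rw [Finset.disjoint_iff_inter_eq_empty, Finset.union_inter_distrib_right, h2, h3]
    rfl
  have := Finset.card_le_univ (tt i ∪ tt j ∪ tt k)
  rw [e2, Fintype.card_fin] at this
  omega

def Free (PS : Finset ℕ) : Prop :=
  ∀ a ∈ PS, ∀ b ∈ PS, ∀ c ∈ PS, ∀ d ∈ PS, adj a b → adj b c → adj c d →
    ¬adj a c → ¬adj b d → ¬adj a d → False

def OkSound (PS : Finset ℕ) (ok : ℕ → ℕ → ℕ → Bool) : Prop :=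
  ∀ J NI f, (∀ i, J.testBit i = true → i ∈ PS) → f ∈ PS → J.testBit f = false →
    ok J NI f = true

theorem okA_sound (PS : Finset ℕ) (hPS : ∀ i ∈ PS, i < 56) (hf : Free PS) : OkSound PS okA := by
  intro J NI f hJ hfP hfJ
  unfold okA
  rw [force_eq]
  rcases h1 : Nat.land (nb f J) NI with _ | m
  · rfl
  · simp only
    rw [← Nat.succ_eq_add_one] at h1
    set x := Nat.log2 (Nat.succ m) with hx
    rcases h2 : nb x J with _ | p
    · rfl
    · simp only
      set y := Nat.log2 (Nat.succ p) with hy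
      have hxb : (nb f J &&& NI).testBit x = true := by
        have h1' : nb f J &&& NI = Nat.succ m := h1
        rw [h1', hx]; exact Nat.testBit_log2 (by omega)
      have hyb : (nb x J).testBit y = true := by
        rw [h2, hy]; exact Nat.testBit_log2 (by omega)
      rw [Nat.testBit_and, nb_bit] at hxb
      rw [nb_bit] at hyb
      simp only [Bool.and_eq_true] at hxb hyb
      obtain ⟨⟨hfx, hxJ⟩, -⟩ := hxb
      obtain ⟨hxy, hyJ⟩ := hyb
      have hxP := hJ x hxJ
      have hyP := hJ y hyJ
      have bf := hPS f hfP
      have bx := hPS x hxP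
      have bY := hPS y hyP
      rw [Nat.beq_eq]
      apply Nat.eq_of_testBit_eq
      intro z
      rw [nb_bit, nb_bit]
      by_cases hz : J.testBit z = true
      · rw [hz, Bool.and_true, Bool.and_true]
        have hzP := hJ z hz
        have bz := hPS z hzP
        rw [Bool.eq_iff_iff]
        change adj y z ↔ adj f z
        have hfx' : adj f x := hfx
        have hxy' : adj x y := hxy
        constructor
        · intro hyz
          by_contra hfz
          exact hf f hfP x hxP y hyP z hzP hfx' hxy' hyz
            (fun h => adj_tri bf bx bY hfx' hxy' h)
            (fun h => adj_tri bx bY bz hxy' hyz h) hfz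
        · intro hfz
          by_contra hyz
          exact hf z hzP f hfP x hxP y hyP (adj_symm bf bz hfz) hfx' hxy'
            (fun h => adj_tri bf bz bx hfz h hfx')
            (fun h => adj_tri bf bx bY hfx' hxy' h) (fun h => hyz (adj_symm bz bY h))
      · simp [hz]

theorem okB_sound (PS : Finset ℕ) (hPS : ∀ i ∈ PS, i < 56)
    (hf : ∀ a ∈ PS, ∀ b ∈ PS, ∀ c ∈ PS, adj a b → adj a c → b = c) : OkSound PS okB := by
  intro J NI f hJ hfP hfJ
  unfold okB
  rcases h1 : nb f J with _ | m
  · rfl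
  · simp only
    set x := Nat.log2 (Nat.succ m) with hx
    have hxb : (nb f J).testBit x = true := by
      rw [h1, hx]; exact Nat.testBit_log2 (by omega)
    rw [nb_bit] at hxb
    simp only [Bool.and_eq_true] at hxb
    obtain ⟨hfx, hxJ⟩ := hxb
    have hxP := hJ x hxJ
    have bf := hPS f hfP
    have bx := hPS x hxP
    have e1 : 1 <<< x = Nat.succ m := by
      have h1' : nb f J = Nat.succ m := h1
      rw [← h1', Nat.one_shiftLeft]
      apply Nat.eq_of_testBit_eq
      intro z
      rw [nb_bit, Nat.testBit_two_pow, Bool.eq_iff_iff]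
      simp only [decide_eq_true_eq, Bool.and_eq_true]
      constructor
      · rintro rfl; exact ⟨hfx, hxJ⟩
      · rintro ⟨h, hz⟩
        exact hf f hfP x hxP z (hJ z hz) hfx h
    have e2 : Nat.beq (Nat.shiftLeft 1 x) (Nat.succ m) = true :=
      by rw [Nat.beq_eq]; exact e1
    rw [e2, cond_true, Nat.beq_eq]
    apply Nat.eq_of_testBit_eq
    intro z
    rw [nb_bit, Nat.zero_testBit, Bool.and_eq_false_iff]
    by_contra hc
    push Not at hc
    simp only [ne_eq, Bool.not_eq_false] at hc
    obtain ⟨h, hz⟩ := hc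
    have hzP := hJ z hz
    have := hf x hxP f hfP z hzP (adj_symm bf bx hfx) h
    subst this
    rw [hz] at hfJ
    cases hfJ

theorem filt_sound (PS : Finset ℕ) (h22 : 22 ≤ PS.card) (I : Finset ℕ) (ok : ℕ → Bool)
    (hok : ∀ f ∈ PS, f ∉ I → ok f = true) (U : List ℕ) :
    ∀ (s : ℕ) (k : List ℕ → ℕ → Bool) (K : Finset ℕ) (c : ℕ), filt ok U s k = true →
      I ⊆ K → PS ⊆ K ∪ U.toFinset → K.card ≤ c → c + U.length ≤ s + 22 →
      ∃ U' s', k U' s' = true ∧ PS ⊆ K ∪ U'.toFinset ∧ c + U'.length ≤ s' + 22 := by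
  induction U with
  | nil =>
    intro s k K c h hI hP hc hs
    exact ⟨[], s, h, hP, hs⟩
  | cons f U ih =>
    intro s k K c h hI hP hc hs
    change cond (ok f) (filt ok U s (fun U' s' => k (f :: U') s'))
        (Nat.rec (motive := fun _ => Bool) true (fun s' _ => filt ok U s' k) s) = true at h
    have hl : (f :: U).length = U.length + 1 := rfl
    have hins : K ∪ (f :: U).toFinset = insert f K ∪ U.toFinset := by
      ext z; simp
    cases hf : ok f with
    | true =>
      rw [hf, cond_true] at h
      rw [hins] at hP
      obtain ⟨U', s', h1, h2, h3⟩ := ih s _ (insert f K) (c + 1) h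
        (hI.trans (Finset.subset_insert _ _)) hP
        ((Finset.card_insert_le _ _).trans (by omega)) (by omega)
      refine ⟨f :: U', s', h1, ?_, ?_⟩
      · intro z hz
        have := h2 hz
        simp at this ⊢
        tauto
      · rw [List.length_cons]; omega
    | false =>
      rw [hf, cond_false] at h
      have hP' : PS ⊆ K ∪ U.toFinset := by
        intro z hz
        have h1 := hP hz
        by_cases hzf : z = f
        · subst hzf
          have : z ∈ I := by
            by_contra hn
            have := hok z hz hn
            rw [hf] at this; cases this
          exact Finset.mem_union_left _ (hI this)
        · simp at h1 ⊢
          tauto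
      cases s with
      | zero =>
        exfalso
        have h1 := Finset.card_le_card hP'
        have h2 := Finset.card_union_le K U.toFinset
        have h3 := U.toFinset_card_le
        omega
      | succ s' => exact ih s' k K c h hI hP' hc (by omega)

theorem go_sound (PS : Finset ℕ) (h22 : 22 ≤ PS.card)
    (ok : ℕ → ℕ → ℕ → Bool) (leaf : ℕ → Bool) (hok : OkSound PS ok) (n : ℕ) :
    ∀ (U : List ℕ) (J NI s : ℕ) (I : Finset ℕ), go ok leaf n U J NI s = true →
      (∀ i, J.testBit i = true ↔ i ∈ I) → I ⊆ PS → PS ⊆ I ∪ U.toFinset →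
      I.card + U.length ≤ s + 22 →
      ∃ m, leaf m = true ∧ ∀ i, m.testBit i = true ↔ i ∈ PS := by
  induction n with
  | zero => intro U J NI s I h; cases h
  | succ n ih =>
    intro U J NI s I h hJ hI hP hs
    cases U with
    | nil =>
      refine ⟨J, h, fun i => ?_⟩
      rw [hJ]
      have : PS ⊆ I := by simpa using hP
      exact ⟨fun h => hI h, fun h => this h⟩
    | cons f U =>
      change cond
            (force (Nat.lor J (Nat.shiftLeft 1 f)) fun J' =>
              force (Nat.rec (motive := fun _ => ℕ) NI
                  (fun m _ => Nat.lor (Nat.lor NI (Nat.succ m)) (Nat.shiftLeft 1 f))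
                  (nb f J)) fun NI' =>
                filt (ok J' NI') U s (fun U' s' => go ok leaf n U' J' NI' s'))
            (Nat.rec (motive := fun _ => Bool) true (fun s' _ => go ok leaf n U J NI s') s)
            false = true at h
      rw [force_eq, force_eq] at h
      generalize Nat.rec (motive := fun _ => ℕ) NI
                  (fun m _ => Nat.lor (Nat.lor NI (Nat.succ m)) (Nat.shiftLeft 1 f))
                  (nb f J) = NI' at h
      rw [Bool.cond_false_right, Bool.and_eq_true] at h
      obtain ⟨hin, hex⟩ := h
      have hl : (f :: U).length = U.length + 1 := rfl
      have hins : I ∪ (f :: U).toFinset = insert f I ∪ U.toFinset := by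
        ext z; simp
      by_cases hf : f ∈ PS
      · have hJ' : ∀ i, (Nat.lor J (Nat.shiftLeft 1 f)).testBit i = true ↔ i ∈ insert f I := by
          intro i
          change (J ||| (1 <<< f)).testBit i = true ↔ _
          rw [Nat.testBit_or, Nat.one_shiftLeft, Nat.testBit_two_pow, Bool.or_eq_true, hJ,
            Finset.mem_insert, decide_eq_true_eq]
          tauto
        have hI' : insert f I ⊆ PS := by
          intro z hz
          rcases Finset.mem_insert.1 hz with rfl | hz
          · exact hf
          · exact hI hz
        rw [hins] at hP
        have hc := Finset.card_insert_le f I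
        obtain ⟨U', s', h1, h2, h3⟩ := filt_sound PS h22 (insert f I) _
          (by
            intro g hg hgI
            refine hok _ _ _ (fun i hi => hI' ((hJ' i).1 hi)) hg ?_
            rw [← Bool.not_eq_true, hJ']
            exact hgI) U s _ (insert f I) (insert f I).card hin (Finset.Subset.refl _) hP le_rfl
          (by omega)
        exact ih U' _ _ s' (insert f I) h1 hJ' hI' h2 h3
      · have hP' : PS ⊆ I ∪ U.toFinset := by
          intro z hz
          have h1 := hP hz
          have : z ≠ f := fun e => hf (e ▸ hz)
          simp at h1 ⊢
          tauto
        cases s with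
        | zero =>
          exfalso
          have h1 := Finset.card_le_card hP'
          have h2 := Finset.card_union_le I U.toFinset
          have h3 := U.toFinset_card_le
          omega
        | succ s' => exact ih U J NI s' I hex hJ hI hP' (by omega)

theorem start_sound (PS : Finset ℕ) (h22 : 22 ≤ PS.card) (hPS : ∀ i ∈ PS, i < 56)
    (ok : ℕ → ℕ → ℕ → Bool) (leaf : ℕ → Bool) (hok : OkSound PS ok)
    (U : List ℕ) (J s : ℕ) (I : Finset ℕ) (h : start ok leaf J U s = true)
    (hJ : ∀ i, J.testBit i = true ↔ i ∈ I) (hI : I ⊆ PS)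
    (hU : Finset.range 56 ⊆ I ∪ U.toFinset) (hs : I.card + U.length ≤ s + 22) :
    ∃ m, leaf m = true ∧ ∀ i, m.testBit i = true ↔ i ∈ PS := by
  have hP : PS ⊆ I ∪ U.toFinset := fun z hz => hU (Finset.mem_range.2 (hPS z hz))
  obtain ⟨U', s', h1, h2, h3⟩ := filt_sound PS h22 I _
    (by
      intro g hg hgI
      refine hok _ _ _ (fun i hi => hI ((hJ i).1 hi)) hg ?_
      rw [← Bool.not_eq_true, hJ]
      exact hgI) U s _ I I.card h (Finset.Subset.refl _) hP le_rfl hs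
  exact go_sound PS h22 ok leaf hok 57 U' J J s' I h1 hJ hI h2 h3

/-- What a successful leaf gives. -/
def Good (PS : Finset ℕ) : Prop :=
  ∃ c : Fin 8, (∃ f, f < 56 ∧ c ∉ tt f ∧ ∀ i < 56, i ∈ PS ↔ StP c f i) ∨
    (∃ f g, f < 56 ∧ g < 56 ∧ c ∉ tt f ∪ tt g ∧ (tt f ∩ tt g).card = 1 ∧
      ∀ i < 56, i ∈ PS ↔ SPP c f g i) ∨
    (∃ A : Finset (Fin 8), A.card = 4 ∧ c ∉ A ∧ ∀ i < 56, i ∈ PS ↔ SKP c A i)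

theorem good_of_leaf (PS : Finset ℕ)
    (h : ∃ m, leaf m = true ∧ ∀ i, m.testBit i = true ↔ i ∈ PS) : Good PS := by
  obtain ⟨m, hm, hi⟩ := h
  unfold leaf at hm
  rw [List.any_eq_true] at hm
  obtain ⟨c, -, hc⟩ := hm
  refine ⟨c, ?_⟩
  unfold leafAt at hc
  split_ifs at hc
  · obtain ⟨h1, h2, h3⟩ := of_decide_eq_true hc
    exact Or.inl ⟨_, h1, h2, fun i hh => (hi i).symm.trans (h3 i hh)⟩
  · obtain ⟨h1, h2, h3, h4, h5⟩ := of_decide_eq_true hc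
    exact Or.inr (Or.inl ⟨_, _, h1, h2, h3, h4, fun i hh => (hi i).symm.trans (h5 i hh)⟩)
  · obtain ⟨h1, h2, h3⟩ := of_decide_eq_true hc
    exact Or.inr (Or.inr ⟨_, h1, h2, fun i hh => (hi i).symm.trans (h3 i hh)⟩)

theorem bits_of {J : ℕ} {I : Finset ℕ} (h : J = ∑ i ∈ I, 2 ^ i) (i : ℕ) :
    J.testBit i = true ↔ i ∈ I := by
  have := Finset.toFinset_bitIndices_sum_two_pow I
  rw [← h] at this
  rw [← this, List.mem_toFinset, Nat.mem_bitIndices]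

theorem good3 (PS : Finset ℕ) (h22 : 22 ≤ PS.card) (hPS : ∀ i ∈ PS, i < 56)
    (hf : ∀ a ∈ PS, ∀ b ∈ PS, ∀ c ∈ PS, adj a b → adj a c → b = c)
    (h0 : 0 ∈ PS) (h19 : 19 ∈ PS) : Good PS := by
  apply good_of_leaf
  refine start_sound PS h22 hPS okB leaf (okB_sound PS hPS hf) ord3 524289 34 {0, 19} run3
    (bits_of (by decide)) ?_ (by decide) (by decide)
  intro z hz; simp at hz; rcases hz with rfl | rfl <;> assumption

theorem good2 (PS : Finset ℕ) (h22 : 22 ≤ PS.card) (hPS : ∀ i ∈ PS, i < 56)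
    (hf : Free PS) (h0 : 0 ∈ PS) (h19 : 19 ∈ PS) (h53 : 53 ∈ PS) : Good PS := by
  apply good_of_leaf
  refine start_sound PS h22 hPS okA leaf (okA_sound PS hPS hf) ord2 9007199255265281 34
    {0, 19, 53} run2 (bits_of (by decide)) ?_ (by decide) (by decide)
  intro z hz; simp at hz; rcases hz with rfl | rfl | rfl <;> assumption

theorem good1 (PS : Finset ℕ) (h22 : 22 ≤ PS.card) (hPS : ∀ i ∈ PS, i < 56)
    (hf : Free PS) (h0 : 0 ∈ PS) (h19 : 19 ∈ PS) (h29 : 29 ∈ PS) : Good PS := by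
  apply good_of_leaf
  refine start_sound PS h22 hPS okA leaf (okA_sound PS hPS hf) ord1 537395201 34
    {0, 19, 29} run1 (bits_of (by decide)) ?_ (by decide) (by decide)
  intro z hz; simp at hz; rcases hz with rfl | rfl | rfl <;> assumption

/-- The `i`-th triple of the vertex set enumerated by `w`. -/
def E (w : Fin 8 → ℕ) (i : ℕ) : Finset ℕ := (tt i).image w

def PSof (w : Fin 8 → ℕ) (H : Finset (Finset ℕ)) : Finset ℕ :=
  (Finset.range 56).filter fun i => E w i ∈ H

theorem mem_PSof {w : Fin 8 → ℕ} {H : Finset (Finset ℕ)} {i : ℕ} :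
    i ∈ PSof w H ↔ i < 56 ∧ E w i ∈ H := by
  simp [PSof]

theorem E_inj {w : Fin 8 → ℕ} (hw : Function.Injective w) {i j : ℕ} (hi : i < 56) (hj : j < 56) :
    E w i = E w j ↔ i = j := by
  constructor
  · intro h
    exact tt_inj i hi j hj (Finset.image_injective hw h)
  · rintro rfl; rfl

theorem E_card {w : Fin 8 → ℕ} (hw : Function.Injective w) {i : ℕ} (hi : i < 56) :
    (E w i).card = 3 := by
  rw [E, Finset.card_image_of_injective _ hw, tt_card i hi]

theorem E_sub {w : Fin 8 → ℕ} {i : ℕ} : E w i ⊆ Finset.univ.image w :=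
  Finset.image_subset_image (Finset.subset_univ _)

theorem mem_E {w : Fin 8 → ℕ} (hw : Function.Injective w) {i : ℕ} {c : Fin 8} :
    w c ∈ E w i ↔ c ∈ tt i := by
  simp [E, hw.eq_iff]

theorem E_surj {w : Fin 8 → ℕ} (hw : Function.Injective w) {e : Finset ℕ}
    (he : e ⊆ Finset.univ.image w) (h3 : e.card = 3) : ∃ i, i < 56 ∧ e = E w i := by
  obtain ⟨s, -, rfl⟩ := Finset.subset_image_iff.1 he
  rw [Finset.card_image_of_injective _ hw] at h3
  obtain ⟨a, b, c, hab, hac, hbc, rfl⟩ := Finset.card_eq_three.1 h3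
  obtain ⟨i, hi, h⟩ := tt_surj3 a b c hab hac hbc
  exact ⟨i, hi, by rw [E, h]⟩

theorem E_inter {w : Fin 8 → ℕ} (hw : Function.Injective w) {i j : ℕ} :
    E w i ∩ E w j = (tt i ∩ tt j).image w := by
  rw [E, E, Finset.image_inter _ _ hw]

theorem adj_iff_E {w : Fin 8 → ℕ} (hw : Function.Injective w) {i j : ℕ} (hi : i < 56)
    (hj : j < 56) : adj i j ↔ E w i ∩ E w j = ∅ := by
  rw [adj_iff hi hj, E_inter hw, Finset.image_eq_empty]

theorem PSof_image {w : Fin 8 → ℕ} (hw : Function.Injective w) {H : Finset (Finset ℕ)}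
    (hH : ThreeGraphOn (Finset.univ.image w) H) : H = (PSof w H).image (E w) := by
  ext e
  simp only [Finset.mem_image, mem_PSof]
  constructor
  · intro he
    obtain ⟨i, hi, rfl⟩ := E_surj hw (hH e he).1 (hH e he).2
    exact ⟨i, ⟨hi, he⟩, rfl⟩
  · rintro ⟨i, ⟨-, h⟩, rfl⟩; exact h

theorem PSof_card {w : Fin 8 → ℕ} (hw : Function.Injective w) {H : Finset (Finset ℕ)}
    (hH : ThreeGraphOn (Finset.univ.image w) H) : H.card = (PSof w H).card := by
  conv_lhs => rw [PSof_image hw hH]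
  apply Finset.card_image_of_injOn
  intro i hi j hj h
  exact (E_inj hw (mem_PSof.1 hi).1 (mem_PSof.1 hj).1).1 h

theorem ext_of {w : Fin 8 → ℕ} (hw : Function.Injective w) {H K : Finset (Finset ℕ)}
    (hH : ThreeGraphOn (Finset.univ.image w) H) (hK : ThreeGraphOn (Finset.univ.image w) K)
    (h : ∀ i < 56, E w i ∈ H ↔ E w i ∈ K) : H = K := by
  have : PSof w H = PSof w K := by
    ext i; rw [mem_PSof, mem_PSof]
    exact ⟨fun ⟨a, b⟩ => ⟨a, (h i a).1 b⟩, fun ⟨a, b⟩ => ⟨a, (h i a).2 b⟩⟩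
  rw [PSof_image hw hH, PSof_image hw hK, this]

theorem free_iff {w : Fin 8 → ℕ} (hw : Function.Injective w) {H : Finset (Finset ℕ)}
    (hH : ThreeGraphOn (Finset.univ.image w) H) : P4Free H ↔ Free (PSof w H) := by
  constructor
  · intro h a ha b hb c hc d hd hab hbc hcd hac hbd had
    rw [mem_PSof] at ha hb hc hd
    rw [adj_iff_E hw (by tauto) (by tauto)] at hab hbc hcd hac hbd had
    apply h
    -- induced path a b c d in the disjointness graph: path  c a d b
    refine ⟨_, hc.2, _, ha.2, _, hd.2, _, hb.2, ?_, ?_, ?_, ?_, ?_, ?_⟩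
    · rw [Finset.inter_comm]; exact Finset.nonempty_iff_ne_empty.2 hac
    · exact Finset.nonempty_iff_ne_empty.2 had
    · rw [Finset.inter_comm]; exact Finset.nonempty_iff_ne_empty.2 hbd
    · exact hcd
    · rw [Finset.inter_comm]; exact hbc
    · exact hab
  · rintro h ⟨a, ha, b, hb, c, hc, d, hd, h1, h2, h3, h4, h5, h6⟩
    obtain ⟨i, hi, rfl⟩ := E_surj hw (hH a ha).1 (hH a ha).2
    obtain ⟨j, hj, rfl⟩ := E_surj hw (hH b hb).1 (hH b hb).2
    obtain ⟨k, hk, rfl⟩ := E_surj hw (hH c hc).1 (hH c hc).2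
    obtain ⟨l, hl, rfl⟩ := E_surj hw (hH d hd).1 (hH d hd).2
    rw [Finset.nonempty_iff_ne_empty, ne_eq] at h1 h2 h3
    -- c a d b
    refine h k (mem_PSof.2 ⟨hk, hc⟩) i (mem_PSof.2 ⟨hi, ha⟩) l (mem_PSof.2 ⟨hl, hd⟩)
      j (mem_PSof.2 ⟨hj, hb⟩) ?_ ?_ ?_ ?_ ?_ ?_
    · rw [adj_iff_E hw hk hi, Finset.inter_comm]; exact h4
    · rw [adj_iff_E hw hi hl]; exact h5
    · rw [adj_iff_E hw hl hj, Finset.inter_comm]; exact h6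
    · rw [adj_iff_E hw hk hl]; exact h3
    · rw [adj_iff_E hw hi hj]; exact h1
    · rw [adj_iff_E hw hk hj, Finset.inter_comm]; exact h2

/-! Membership of the three extremal families. -/

theorem tg_star (V : Finset ℕ) (v : ℕ) (e : Finset ℕ) (he : e ⊆ V) (h3 : e.card = 3) :
    ThreeGraphOn V ((V.powersetCard 3).filter (fun t => v ∈ t) ∪ {e}) := by
  intro t ht
  simp only [Finset.mem_union, Finset.mem_filter, Finset.mem_powersetCard,
    Finset.mem_singleton] at ht
  rcases ht with h | rfl
  · exact h.1
  · exact ⟨he, h3⟩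

theorem tg_SP (V : Finset ℕ) (v : ℕ) (f g : Finset ℕ) (hf : f ⊆ V) (hg : g ⊆ V)
    (hf3 : f.card = 3) (hg3 : g.card = 3) :
    ThreeGraphOn V ({f, g} ∪
      (V.powersetCard 3).filter (fun t => v ∈ t ∧ (t ∩ (f ∪ g)).Nonempty)) := by
  intro t ht
  simp only [Finset.mem_union, Finset.mem_filter, Finset.mem_powersetCard,
    Finset.mem_singleton, Finset.mem_insert] at ht
  rcases ht with (rfl | rfl) | h
  · exact ⟨hf, hf3⟩
  · exact ⟨hg, hg3⟩
  · exact h.1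

theorem tg_SK (V : Finset ℕ) (v : ℕ) (A : Finset ℕ) (hA : A ⊆ V) :
    ThreeGraphOn V (A.powersetCard 3 ∪
      (V.powersetCard 3).filter (fun t => v ∈ t ∧ (t ∩ A).Nonempty)) := by
  intro t ht
  simp only [Finset.mem_union, Finset.mem_filter, Finset.mem_powersetCard] at ht
  rcases ht with h | h
  · exact ⟨h.1.trans hA, h.2⟩
  · exact h.1

theorem mem_star {w : Fin 8 → ℕ} (hw : Function.Injective w) {c : Fin 8} {f i : ℕ}
    (hi : i < 56) (hf : f < 56) :
    E w i ∈ (((Finset.univ.image w).powersetCard 3).filter (fun t => w c ∈ t) ∪ {E w f}) ↔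
      StP c f i := by
  rw [Finset.mem_union, Finset.mem_filter, Finset.mem_powersetCard, Finset.mem_singleton,
    E_inj hw hi hf, mem_E hw, StP]
  have := E_card hw hi
  have := @E_sub w i
  tauto

theorem mem_SP {w : Fin 8 → ℕ} (hw : Function.Injective w) {c : Fin 8} {f g i : ℕ}
    (hi : i < 56) (hf : f < 56) (hg : g < 56) :
    E w i ∈ ({E w f, E w g} ∪ ((Finset.univ.image w).powersetCard 3).filter
      (fun t => w c ∈ t ∧ (t ∩ (E w f ∪ E w g)).Nonempty)) ↔ SPP c f g i := by
  rw [Finset.mem_union, Finset.mem_filter, Finset.mem_powersetCard, Finset.mem_insert,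
    Finset.mem_singleton, E_inj hw hi hf, E_inj hw hi hg, mem_E hw, SPP]
  have h1 : (E w i ∩ (E w f ∪ E w g)).Nonempty ↔ (tt i ∩ (tt f ∪ tt g)).Nonempty := by
    rw [E, E, E, ← Finset.image_union, ← Finset.image_inter _ _ hw, Finset.image_nonempty]
  rw [h1]
  have := E_card hw hi
  have := @E_sub w i
  tauto

theorem mem_SK {w : Fin 8 → ℕ} (hw : Function.Injective w) {c : Fin 8} {A : Finset (Fin 8)} {i : ℕ}
    (hi : i < 56) :
    E w i ∈ ((A.image w).powersetCard 3 ∪ ((Finset.univ.image w).powersetCard 3).filter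
      (fun t => w c ∈ t ∧ (t ∩ A.image w).Nonempty)) ↔ SKP c A i := by
  rw [Finset.mem_union, Finset.mem_filter, Finset.mem_powersetCard, Finset.mem_powersetCard,
    mem_E hw, SKP]
  have h1 : (E w i ∩ A.image w).Nonempty ↔ (tt i ∩ A).Nonempty := by
    rw [E, ← Finset.image_inter _ _ hw, Finset.image_nonempty]
  have h2 : E w i ⊆ A.image w ↔ tt i ⊆ A := by
    rw [E, Finset.image_subset_image_iff hw]
  rw [h1, h2]
  have := E_card hw hi
  have := @E_sub w i
  tauto

theorem of_good {w : Fin 8 → ℕ} (hw : Function.Injective w) {H : Finset (Finset ℕ)}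
    (hH : ThreeGraphOn (Finset.univ.image w) H) (hg : Good (PSof w H)) :
    IsStarPlusOn (Finset.univ.image w) H ∨ IsSPOn (Finset.univ.image w) H ∨
      IsSKOn (Finset.univ.image w) H := by
  obtain ⟨c, h⟩ := hg
  have hcV : w c ∈ Finset.univ.image w := Finset.mem_image_of_mem _ (Finset.mem_univ _)
  rcases h with ⟨f, hf, hcf, h⟩ | ⟨f, g, hf, hg, hc, hfg, h⟩ | ⟨A, hA, hc, h⟩
  · left
    refine ⟨w c, hcV, E w f, E_sub, E_card hw hf, by rwa [mem_E hw], ?_⟩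
    refine ext_of hw hH (tg_star _ _ _ E_sub (E_card hw hf)) fun i hi => ?_
    rw [mem_star hw hi hf, ← h i hi, mem_PSof]
    exact ⟨fun h => ⟨hi, h⟩, fun h => h.2⟩
  · right; left
    refine ⟨w c, hcV, E w f, E w g, E_sub, E_sub, E_card hw hf, E_card hw hg, ?_, ?_, ?_⟩
    · rw [E_inter hw, Finset.card_image_of_injective _ hw, hfg]
    · rw [Finset.mem_union, mem_E hw, mem_E hw, ← Finset.mem_union]; exact hc
    refine ext_of hw hH (tg_SP _ _ _ _ E_sub E_sub (E_card hw hf) (E_card hw hg)) fun i hi => ?_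
    rw [mem_SP hw hi hf hg, ← h i hi, mem_PSof]
    exact ⟨fun h => ⟨hi, h⟩, fun h => h.2⟩
  · right; right
    have hAV : A.image w ⊆ Finset.univ.image w :=
      Finset.image_subset_image (Finset.subset_univ _)
    refine ⟨w c, hcV, A.image w, hAV, ?_, ?_, ?_⟩
    · rw [Finset.card_image_of_injective _ hw, hA]
    · simpa [hw.eq_iff] using hc
    refine ext_of hw hH (tg_SK _ _ _ hAV) fun i hi => ?_
    rw [mem_SK hw hi, ← h i hi, mem_PSof]
    exact ⟨fun h => ⟨hi, h⟩, fun h => h.2⟩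


theorem enum8 {V : Finset ℕ} (hV : V.card = 8) (w : Fin 8 → ℕ) (h : V ⊆ Finset.univ.image w) :
    Function.Injective w ∧ V = Finset.univ.image w := by
  have h1 : (Finset.univ.image w).card ≤ 8 := by
    simpa using (Finset.card_image_le (s := (Finset.univ : Finset (Fin 8))) (f := w))
  have h2 : V = Finset.univ.image w := Finset.eq_of_subset_of_card_le h (by omega)
  refine ⟨?_, h2⟩
  have h3 : Set.InjOn w (Finset.univ : Finset (Fin 8)) :=
    Finset.card_image_iff.1 (by rw [← h2, hV]; rfl)
  exact fun a b h => h3 (by simp) (by simp) h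

theorem cov (a0 a1 a2 a3 a4 a5 a6 a7 z : ℕ) :
    z ∈ Finset.univ.image ![a0, a1, a2, a3, a4, a5, a6, a7] ↔
      z = a0 ∨ z = a1 ∨ z = a2 ∨ z = a3 ∨ z = a4 ∨ z = a5 ∨ z = a6 ∨ z = a7 := by
  simp [Fin.exists_fin_succ, eq_comm]

theorem mem_of_eq {H : Finset (Finset ℕ)} {f g : Finset ℕ} (hf : f ∈ H) (h : f = g) : g ∈ H :=
  h ▸ hf

theorem tt0 : tt 0 = {0, 1, 2} := by decide +kernel
theorem tt19 : tt 19 = {3, 4, 5} := by decide +kernel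
theorem tt29 : tt 29 = {3, 4, 6} := by decide +kernel
theorem tt53 : tt 53 = {3, 6, 7} := by decide +kernel
theorem tt3 : tt 3 = {1, 2, 3} := by decide +kernel
theorem tt17 : tt 17 = {1, 4, 5} := by decide +kernel

theorem E_three {w : Fin 8 → ℕ} {i : ℕ} {a b c : Fin 8} (h : tt i = {a, b, c}) :
    E w i = {w a, w b, w c} := by
  rw [E, h]; simp [Finset.image_insert]

theorem exists_disj {V : Finset ℕ} {H : Finset (Finset ℕ)} (hV : V.card = 8)
    (hH : ThreeGraphOn V H) (h22 : 22 ≤ H.card) : ∃ e ∈ H, ∃ f ∈ H, e ∩ f = ∅ := by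
  by_contra hcon
  push Not at hcon
  obtain ⟨hw, hVw⟩ := enum8 hV (V.orderEmbOfFin hV) (by simp)
  generalize (V.orderEmbOfFin hV : Fin 8 → ℕ) = w at hw hVw
  subst hVw
  have hc := PSof_card hw hH
  have hcard : ((PSof w H).image tt).card = (PSof w H).card := by
    apply Finset.card_image_of_injOn
    intro i hi j hj h
    exact tt_inj i (mem_PSof.1 hi).1 j (mem_PSof.1 hj).1 h
  have := Finset.erdos_ko_rado (n := 8) (𝒜 := (PSof w H).image tt) (r := 3) ?_ ?_ (by norm_num)
  · rw [hcard, ← hc] at this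
    have h7 : (8 - 1).choose (3 - 1) = 21 := by decide
    omega
  · intro S hS S' hS' hd
    simp only [Finset.coe_image, Set.mem_image, Finset.mem_coe, mem_PSof] at hS hS'
    obtain ⟨i, ⟨hi, hiH⟩, rfl⟩ := hS
    obtain ⟨j, ⟨hj, hjH⟩, rfl⟩ := hS'
    have h1 := hcon _ hiH _ hjH
    rw [E_inter hw, Finset.disjoint_iff_inter_eq_empty.1 hd] at h1
    simp at h1
  · intro S hS
    simp only [Finset.coe_image, Set.mem_image, Finset.mem_coe, mem_PSof] at hS
    obtain ⟨i, ⟨hi, hiH⟩, rfl⟩ := hS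
    exact tt_card i hi

set_option maxHeartbeats 1000000 in
theorem core {V : Finset ℕ} {H : Finset (Finset ℕ)} (hV : V.card = 8)
    (hH : ThreeGraphOn V H) (hP : P4Free H) (h22 : 22 ≤ H.card) :
    IsStarPlusOn V H ∨ IsSPOn V H ∨ IsSKOn V H := by
  have key : ∀ w : Fin 8 → ℕ, V ⊆ Finset.univ.image w →
      (∀ PS : Finset ℕ, PS = PSof w H → 22 ≤ PS.card → (∀ i ∈ PS, i < 56) → Free PS →
        Good PS) → IsStarPlusOn V H ∨ IsSPOn V H ∨ IsSKOn V H := by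
    intro w hs hg
    obtain ⟨hw, rfl⟩ := enum8 hV w hs
    refine of_good hw hH (hg _ rfl ?_ (fun i hi => (mem_PSof.1 hi).1) ((free_iff hw hH).1 hP))
    rw [← PSof_card hw hH]; exact h22
  by_cases hm : ∃ e ∈ H, ∃ f ∈ H, ∃ g ∈ H, e ∩ f = ∅ ∧ e ∩ g = ∅ ∧ f ≠ g
  · obtain ⟨e, he, f, hf, g, hg, hef, heg, hfg⟩ := hm
    have hd : Disjoint e (f ∪ g) := by
      rw [Finset.disjoint_iff_inter_eq_empty, Finset.inter_union_distrib_left, hef, heg]; rfl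
    have c1 := Finset.card_union_of_disjoint hd
    have hsub : e ∪ (f ∪ g) ⊆ V :=
      Finset.union_subset (hH e he).1 (Finset.union_subset (hH f hf).1 (hH g hg).1)
    have c2 := Finset.card_le_card hsub
    have c3 := Finset.card_union_add_card_inter f g
    have c4 := (hH e he).2
    have c5 := (hH f hf).2
    have c6 := (hH g hg).2
    have c7 := Finset.card_sdiff_add_card_inter f g
    have c8 := Finset.card_sdiff_add_card_inter g f
    have c9 := Finset.card_sdiff_add_card_eq_card hsub
    rw [Finset.inter_comm g f] at c8
    have c10 : (f ∩ g).card ≠ 3 := by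
      intro h
      have e1 : f ∩ g = f := Finset.eq_of_subset_of_card_le Finset.inter_subset_left (by omega)
      have e2 : f ∩ g = g := Finset.eq_of_subset_of_card_le Finset.inter_subset_right (by omega)
      exact hfg (e1.symm.trans e2)
    have hfe : f = (f ∩ g) ∪ (f \ g) := by ext z; simp; tauto
    have hge : g = (f ∩ g) ∪ (g \ f) := by ext z; simp; tauto
    have hVe : V = e ∪ ((f ∩ g) ∪ (f \ g) ∪ (g \ f)) ∪ (V \ (e ∪ (f ∪ g))) := by
      ext z
      have := @hsub z
      simp at this ⊢
      tauto
    obtain ⟨a0, a1, a2, -, -, -, rfl⟩ := Finset.card_eq_three.1 c4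
    have hcases : (f ∩ g).card = 2 ∨ (f ∩ g).card = 1 := by omega
    rcases hcases with hc | hc
    · obtain ⟨a3, a4, -, h34⟩ := Finset.card_eq_two.1 hc
      obtain ⟨a5, h5⟩ := Finset.card_eq_one.1 (show (f \ g).card = 1 by omega)
      obtain ⟨a6, h6⟩ := Finset.card_eq_one.1 (show (g \ f).card = 1 by omega)
      obtain ⟨a7, h7⟩ := Finset.card_eq_one.1
        (show (V \ ({a0, a1, a2} ∪ (f ∪ g))).card = 1 by omega)
      rw [h7, h34, h5, h6] at hVe
      rw [h34, h5] at hfe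
      rw [h34, h6] at hge
      have r1 : ∀ x : ℕ, ({a3, a4} ∪ {x} : Finset ℕ) = {a3, a4, x} := by
        intro x; ext z; simp
      rw [r1] at hfe hge
      refine key ![a0, a1, a2, a3, a4, a5, a6, a7] ?_ ?_
      · rw [hVe]; intro z hz; rw [cov]; simpa only [Finset.mem_union, Finset.mem_insert,
        Finset.mem_singleton, Finset.notMem_empty, or_false, or_assoc] using hz
      · intro PS hPS h22 hb hfree
        refine good1 PS h22 hb hfree ?_ ?_ ?_
        · rw [hPS, mem_PSof, E_three tt0]; exact ⟨by norm_num, he⟩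
        · rw [hPS, mem_PSof, E_three tt19]; exact ⟨by norm_num, mem_of_eq hf (hfe.trans rfl)⟩
        · rw [hPS, mem_PSof, E_three tt29]; exact ⟨by norm_num, mem_of_eq hg (hge.trans rfl)⟩
    · obtain ⟨a3, h3⟩ := Finset.card_eq_one.1 hc
      obtain ⟨a4, a5, -, h45⟩ := Finset.card_eq_two.1 (show (f \ g).card = 2 by omega)
      obtain ⟨a6, a7, -, h67⟩ := Finset.card_eq_two.1 (show (g \ f).card = 2 by omega)
      have h0 := Finset.card_eq_zero.1
        (show (V \ ({a0, a1, a2} ∪ (f ∪ g))).card = 0 by omega)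
      rw [h0, h3, h45, h67] at hVe
      rw [h3, h45, Finset.singleton_union] at hfe
      rw [h3, h67, Finset.singleton_union] at hge
      refine key ![a0, a1, a2, a3, a4, a5, a6, a7] ?_ ?_
      · rw [hVe]; intro z hz; rw [cov]; simpa only [Finset.mem_union, Finset.mem_insert,
        Finset.mem_singleton, Finset.notMem_empty, or_false, or_assoc] using hz
      · intro PS hPS h22 hb hfree
        refine good2 PS h22 hb hfree ?_ ?_ ?_
        · rw [hPS, mem_PSof, E_three tt0]; exact ⟨by norm_num, he⟩
        · rw [hPS, mem_PSof, E_three tt19]; exact ⟨by norm_num, mem_of_eq hf (hfe.trans rfl)⟩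
        · rw [hPS, mem_PSof, E_three tt53]; exact ⟨by norm_num, mem_of_eq hg (hge.trans rfl)⟩
  · obtain ⟨e, he, f, hf, hef⟩ := exists_disj hV hH h22
    have c1 := Finset.card_union_of_disjoint (Finset.disjoint_iff_inter_eq_empty.2 hef)
    have hsub : e ∪ f ⊆ V := Finset.union_subset (hH e he).1 (hH f hf).1
    have c4 := (hH e he).2
    have c5 := (hH f hf).2
    have c9 := Finset.card_sdiff_add_card_eq_card hsub
    have hVe : V = e ∪ f ∪ (V \ (e ∪ f)) := (Finset.union_sdiff_of_subset hsub).symm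
    obtain ⟨a0, a1, a2, -, -, -, rfl⟩ := Finset.card_eq_three.1 c4
    obtain ⟨a3, a4, a5, -, -, -, rfl⟩ := Finset.card_eq_three.1 c5
    obtain ⟨a6, a7, -, h67⟩ := Finset.card_eq_two.1
      (show (V \ ({a0, a1, a2} ∪ {a3, a4, a5})).card = 2 by omega)
    rw [h67] at hVe
    have hs : V ⊆ Finset.univ.image ![a0, a1, a2, a3, a4, a5, a6, a7] := by
      rw [hVe]; intro z hz; rw [cov]; simpa only [Finset.mem_union, Finset.mem_insert,
        Finset.mem_singleton, Finset.notMem_empty, or_false, or_assoc] using hz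
    refine key ![a0, a1, a2, a3, a4, a5, a6, a7] hs ?_
    obtain ⟨hw, -⟩ := enum8 hV _ hs
    intro PS hPS h22 hb hfree
    refine good3 PS h22 hb ?_ ?_ ?_
    · intro a ha b hb c hc hab hac
      rw [hPS, mem_PSof] at ha hb hc
      rw [adj_iff_E hw ha.1 hb.1] at hab
      rw [adj_iff_E hw ha.1 hc.1] at hac
      by_contra hbc
      exact hm ⟨_, ha.2, _, hb.2, _, hc.2, hab, hac, fun h => hbc ((E_inj hw hb.1 hc.1).1 h)⟩
    · rw [hPS, mem_PSof, E_three tt0]; exact ⟨by norm_num, he⟩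
    · rw [hPS, mem_PSof, E_three tt19]; exact ⟨by norm_num, hf⟩

/-! The three extremal examples. -/

def adjb (i j : ℕ) : Bool := tab.testBit (56 * i + j)

def chk (L : List ℕ) : Bool :=
  L.all fun a => L.all fun b => !adjb a b || L.all fun c => !adjb b c || adjb a c ||
    L.all fun d => !adjb c d || adjb b d || adjb a d

theorem free_of_chk (L : List ℕ) (h : chk L = true) : Free L.toFinset := by
  intro a ha b hb c hc d hd h1 h2 h3 h4 h5 h6
  rw [List.mem_toFinset] at ha hb hc hd
  unfold chk at h
  simp only [List.all_eq_true, Bool.or_eq_true, Bool.not_eq_true'] at h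
  change adjb a b = true at h1
  change adjb b c = true at h2
  change adjb c d = true at h3
  change ¬adjb a c = true at h4
  change ¬adjb b d = true at h5
  change ¬adjb a d = true at h6
  have e1 := (h a ha b hb).resolve_left (by simp [h1]) c hc
  have e2 := (e1.resolve_left (by simp [h2, h4])) d hd
  simp [h3, h5, h6] at e2

def L1 : List ℕ := [0, 1, 2, 3, 4, 5, 7, 10, 11, 13, 16, 20, 21, 23, 26, 30, 35, 36, 38, 41, 45, 50]
def L2 : List ℕ := [0, 1, 2, 3, 4, 5, 7, 10, 11, 13, 16, 17, 20, 21, 23, 26, 30, 35, 36, 38, 41, 45]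
def L3 : List ℕ := [0, 1, 2, 3, 4, 5, 6, 7, 8, 9, 10, 11, 13, 16, 20, 21, 23, 26, 35, 36, 38, 41]

theorem chk1 : chk L1 = true := by decide +kernel
theorem chk2 : chk L2 = true := by decide +kernel
theorem chk3 : chk L3 = true := by decide +kernel
theorem spec1 : ∀ i < 56, StP 0 3 i ↔ i ∈ L1 := by decide +kernel
theorem spec2 : ∀ i < 56, SPP 0 3 17 i ↔ i ∈ L2 := by decide +kernel
theorem spec3 : ∀ i < 56, SKP 0 {1, 2, 3, 4} i ↔ i ∈ L3 := by decide +kernel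

theorem ex_of {w : Fin 8 → ℕ} (hw : Function.Injective w) {H : Finset (Finset ℕ)}
    (hH : ThreeGraphOn (Finset.univ.image w) H) (L : List ℕ) (hL : chk L = true)
    (hc : L.toFinset.card = 22) (hb : ∀ i ∈ L, i < 56)
    (h : ∀ i < 56, E w i ∈ H ↔ i ∈ L) : P4Free H ∧ H.card = 22 := by
  have : PSof w H = L.toFinset := by
    ext i
    rw [mem_PSof, List.mem_toFinset]
    exact ⟨fun ⟨a, b⟩ => (h i a).1 b, fun a => ⟨hb i a, (h i (hb i a)).2 a⟩⟩
  rw [free_iff hw hH, PSof_card hw hH, this]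
  exact ⟨free_of_chk L hL, hc⟩

theorem ex_star {V : Finset ℕ} {H : Finset (Finset ℕ)} (hV : V.card = 8)
    (h : IsStarPlusOn V H) : ThreeGraphOn V H ∧ P4Free H ∧ H.card = 22 := by
  obtain ⟨v, hv, e, heV, he3, hve, rfl⟩ := h
  have hT := tg_star V v e heV he3
  refine ⟨hT, ?_⟩
  have hsub : insert v e ⊆ V := Finset.insert_subset hv heV
  have c1 := Finset.card_insert_of_notMem hve
  have c2 := Finset.card_sdiff_add_card_eq_card hsub
  have hVe : V = insert v e ∪ (V \ insert v e) := (Finset.union_sdiff_of_subset hsub).symm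
  obtain ⟨a1, a2, a3, -, -, -, rfl⟩ := Finset.card_eq_three.1 he3
  obtain ⟨a4, t, -, ht, ht3⟩ := Finset.card_eq_succ.1
    (show (V \ insert v {a1, a2, a3}).card = 3 + 1 by omega)
  obtain ⟨a5, a6, a7, -, -, -, rfl⟩ := Finset.card_eq_three.1 ht3
  rw [← ht] at hVe
  obtain ⟨hw, hVw⟩ := enum8 hV ![v, a1, a2, a3, a4, a5, a6, a7] (by
    rw [hVe]; intro z hz; rw [cov]; simpa only [Finset.mem_union, Finset.mem_insert,
        Finset.mem_singleton, Finset.notMem_empty, or_false, or_assoc] using hz)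
  have hE : ({a1, a2, a3} : Finset ℕ) = E ![v, a1, a2, a3, a4, a5, a6, a7] 3 := by
    rw [E_three tt3]; rfl
  have hv0 : v = ![v, a1, a2, a3, a4, a5, a6, a7] 0 := rfl
  rw [hE] at hT ⊢
  clear hE hVe ht c2 hsub heV c1 he3 hve
  generalize ![v, a1, a2, a3, a4, a5, a6, a7] = w at *
  subst hv0
  subst hVw
  refine ex_of hw hT L1 chk1 (by decide +kernel) (by decide +kernel) fun i hi => ?_
  rw [mem_star hw hi (by norm_num), spec1 i hi]

theorem ex_SP {V : Finset ℕ} {H : Finset (Finset ℕ)} (hV : V.card = 8)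
    (h : IsSPOn V H) : ThreeGraphOn V H ∧ P4Free H ∧ H.card = 22 := by
  obtain ⟨v, hv, f, g, hfV, hgV, hf3, hg3, hfg, hvfg, rfl⟩ := h
  have hT := tg_SP V v f g hfV hgV hf3 hg3
  refine ⟨hT, ?_⟩
  have hsub : insert v (f ∪ g) ⊆ V := Finset.insert_subset hv (Finset.union_subset hfV hgV)
  have c1 := Finset.card_insert_of_notMem hvfg
  have c2 := Finset.card_sdiff_add_card_eq_card hsub
  have c3 := Finset.card_union_add_card_inter f g
  have c7 := Finset.card_sdiff_add_card_inter f g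
  have c8 := Finset.card_sdiff_add_card_inter g f
  rw [Finset.inter_comm g f] at c8
  have hfe : f = (f ∩ g) ∪ (f \ g) := by ext z; simp; tauto
  have hge : g = (f ∩ g) ∪ (g \ f) := by ext z; simp; tauto
  have hVe : V = insert v ((f ∩ g) ∪ (f \ g) ∪ (g \ f)) ∪ (V \ insert v (f ∪ g)) := by
    ext z
    have := @hsub z
    simp at this ⊢
    tauto
  obtain ⟨a1, h1⟩ := Finset.card_eq_one.1 hfg
  obtain ⟨a2, a3, -, h23⟩ := Finset.card_eq_two.1 (show (f \ g).card = 2 by omega)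
  obtain ⟨a4, a5, -, h45⟩ := Finset.card_eq_two.1 (show (g \ f).card = 2 by omega)
  obtain ⟨a6, a7, -, h67⟩ := Finset.card_eq_two.1
    (show (V \ insert v (f ∪ g)).card = 2 by omega)
  rw [h67, h1, h23, h45] at hVe
  rw [h1, h23] at hfe
  rw [h1, h45] at hge
  obtain ⟨hw, hVw⟩ := enum8 hV ![v, a1, a2, a3, a4, a5, a6, a7] (by
    rw [hVe]; intro z hz; rw [cov]; simpa only [Finset.mem_union, Finset.mem_insert,
        Finset.mem_singleton, Finset.notMem_empty, or_false, or_assoc] using hz)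
  have hE : f = E ![v, a1, a2, a3, a4, a5, a6, a7] 3 := by
    rw [E_three tt3, hfe]; rfl
  have hE' : g = E ![v, a1, a2, a3, a4, a5, a6, a7] 17 := by
    rw [E_three tt17, hge]; rfl
  have hv0 : v = ![v, a1, a2, a3, a4, a5, a6, a7] 0 := rfl
  clear hfe hge hVe h1 h23 h45 h67 c1 c2 c3 c7 c8 hsub hfV hgV hf3 hg3 hfg hvfg
  generalize ![v, a1, a2, a3, a4, a5, a6, a7] = w at *
  subst hv0 hVw hE hE'
  refine ex_of hw hT L2 chk2 (by decide +kernel) (by decide +kernel) fun i hi => ?_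
  rw [mem_SP hw hi (by norm_num) (by norm_num), spec2 i hi]

theorem ex_SK {V : Finset ℕ} {H : Finset (Finset ℕ)} (hV : V.card = 8)
    (h : IsSKOn V H) : ThreeGraphOn V H ∧ P4Free H ∧ H.card = 22 := by
  obtain ⟨v, hv, A, hAV, hA4, hvA, rfl⟩ := h
  have hT := tg_SK V v A hAV
  refine ⟨hT, ?_⟩
  have hsub : insert v A ⊆ V := Finset.insert_subset hv hAV
  have c1 := Finset.card_insert_of_notMem hvA
  have c2 := Finset.card_sdiff_add_card_eq_card hsub
  have hVe : V = insert v A ∪ (V \ insert v A) := (Finset.union_sdiff_of_subset hsub).symm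
  obtain ⟨a5, a6, a7, -, -, -, h567⟩ := Finset.card_eq_three.1
    (show (V \ insert v A).card = 3 by omega)
  obtain ⟨a1, t, -, ht, ht3⟩ := Finset.card_eq_succ.1 (show A.card = 3 + 1 by omega)
  obtain ⟨a2, a3, a4, -, -, -, rfl⟩ := Finset.card_eq_three.1 ht3
  rw [h567, ← ht] at hVe
  obtain ⟨hw, hVw⟩ := enum8 hV ![v, a1, a2, a3, a4, a5, a6, a7] (by
    rw [hVe]; intro z hz; rw [cov]; simpa only [Finset.mem_union, Finset.mem_insert,
        Finset.mem_singleton, Finset.notMem_empty, or_false, or_assoc] using hz)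
  have hE : A = ({1, 2, 3, 4} : Finset (Fin 8)).image ![v, a1, a2, a3, a4, a5, a6, a7] := by
    rw [← ht]; simp [Finset.image_insert]
  have hv0 : v = ![v, a1, a2, a3, a4, a5, a6, a7] 0 := rfl
  clear hVe ht ht3 h567 c1 c2 hsub hAV hA4 hvA
  generalize ![v, a1, a2, a3, a4, a5, a6, a7] = w at *
  subst hv0 hVw hE
  refine ex_of hw hT L3 chk3 (by decide +kernel) (by decide +kernel) fun i hi => ?_
  rw [mem_SK hw hi, spec3 i hi]

theorem ex_all {V : Finset ℕ} {H : Finset (Finset ℕ)} (hV : V.card = 8)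
    (h : IsStarPlusOn V H ∨ IsSPOn V H ∨ IsSKOn V H) :
    ThreeGraphOn V H ∧ P4Free H ∧ H.card = 22 := by
  rcases h with h | h | h
  · exact ex_star hV h
  · exact ex_SP hV h
  · exact ex_SK hV h

end TP4

/-- `ex₃(8; 𝒫₄) = 22`, and the extremal 3-graphs on 8 vertices are exactly
`S₈⁺¹`, `SP₈`, and `SK₈`. -/
theorem turan_P4_eight :
    (∀ V : Finset ℕ, ∀ H : Finset (Finset ℕ),
        V.card = 8 → ThreeGraphOn V H → P4Free H → H.card ≤ 22) ∧
    (∀ V : Finset ℕ, ∀ H : Finset (Finset ℕ), V.card = 8 →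
        (IsStarPlusOn V H ∨ IsSPOn V H ∨ IsSKOn V H) →
        ThreeGraphOn V H ∧ P4Free H ∧ H.card = 22) ∧
    (∀ V : Finset ℕ, ∀ H : Finset (Finset ℕ),
        V.card = 8 → ThreeGraphOn V H → P4Free H → H.card = 22 →
        (IsStarPlusOn V H ∨ IsSPOn V H ∨ IsSKOn V H)) := by
  refine ⟨fun V H hV hH hP => ?_, fun V H hV h => TP4.ex_all hV h, fun V H hV hH hP hc => ?_⟩
  · by_contra hlt
    have h := TP4.ex_all hV (TP4.core hV hH hP (by omega))
    omega
  · exact TP4.core hV hH hP (by omega)
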